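/- arXiv:2002.12361 — 4 statements merged into one kernel-verified Lean document; each statement's English description precedes it below -/
import Mathlib

section
/- Let V_0, V_1, V_2, … be defined by the sub-goal tree dynamic programming (SGTDP) recursion: V_0(s,s') = c(s,s') for all s ≠ s'; V_k(s,s) = 0 for all s and all k; and V_k(s,s') = min over s_m ∈ S of ( V_{k-1}(s, s_m) + V_{k-1}(s_m, s') ) for all s ≠ s' and k ≥ 1. Then for every k ≥ 0 and all s, s' ∈ S, V_k(s,s') equals the infimum of the costs of paths from s to s' using at most 2^k edges. -/
open scoped ENNReal

noncomputable section

/-- The cost of a path given as a list of visited vertices: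
the sum of edge costs of consecutive vertices. A path with 0 edges has cost 0. -/
def pathCost {S : Type*} (c : S → S → ℝ≥0∞) : List S → ℝ≥0∞
  | [] => 0
  | [_] => 0
  | a :: b :: rest => c a b + pathCost c (b :: rest)

/-- The infimum of the costs of paths from `s` to `g` using at most `n` edges
(i.e. visiting at most `n + 1` vertices). -/
def minCostLe {S : Type*} (c : S → S → ℝ≥0∞) (n : ℕ) (s g : S) : ℝ≥0∞ :=
  sInf {x | ∃ p : List S, p.head? = some s ∧ p.getLast? = some g ∧
    p.length ≤ n + 1 ∧ pathCost c p = x}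

theorem pathCost_append_cons {S : Type*} (c : S → S → ℝ≥0∞) (x : S) (r : List S) :
    ∀ p : List S, pathCost c (p ++ x :: r) = pathCost c (p ++ [x]) + pathCost c (x :: r)
  | [] => by simp [pathCost]
  | [a] => by simp [pathCost]
  | a :: b :: p => by
    have h := pathCost_append_cons c x r (b :: p)
    simp only [List.cons_append, pathCost] at h ⊢
    rw [h, add_assoc]

theorem minCostLe_le_pathCost {S : Type*} (c : S → S → ℝ≥0∞) {n : ℕ} {s g : S} {p : List S}
    (hs : p.head? = some s) (hg : p.getLast? = some g) (hn : p.length ≤ n + 1) :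
    minCostLe c n s g ≤ pathCost c p :=
  sInf_le ⟨p, hs, hg, hn, rfl⟩

theorem exists_split_path {S : Type*} (c : S → S → ℝ≥0∞) (n : ℕ) (g : S) (m : ℕ) :
    ∀ (s : S) (p : List S), p.head? = some s → p.getLast? = some g →
      p.length ≤ m + n + 1 →
      ∃ (x : S) (q r : List S), q.head? = some s ∧ q.getLast? = some x ∧ q.length ≤ m + 1 ∧
        r.head? = some x ∧ r.getLast? = some g ∧ r.length ≤ n + 1 ∧
        pathCost c q + pathCost c r = pathCost c p := by
  induction m with
  | zero =>
    intro s p hs hg hp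
    exact ⟨s, [s], p, rfl, rfl, by simp, hs, hg, by omega, by simp [pathCost]⟩
  | succ m ih =>
    intro s p hs hg hp
    match p with
    | [] => simp at hs
    | [a] =>
      exact ⟨g, [a], [g], hs, hg, by simp, rfl, rfl, by simp, by simp [pathCost]⟩
    | a :: b :: t =>
      obtain ⟨x, q, r, hqb, hqx, hqm, hrx, hrg, hrn, hc⟩ :=
        ih b (b :: t) rfl (by simpa using hg) (by simp at hp ⊢; omega)
      obtain ⟨u, rfl⟩ := List.head?_eq_some_iff.mp hqb
      refine ⟨x, a :: b :: u, r, by simpa using hs, by simpa using hqx, by simpa using hqm,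
        hrx, hrg, hrn, ?_⟩
      simp only [pathCost, ← hc, add_assoc]

theorem minCostLe_add {S : Type*} (c : S → S → ℝ≥0∞) (m n : ℕ) (s g : S) :
    minCostLe c (m + n) s g = ⨅ x : S, (minCostLe c m s x + minCostLe c n x g) := by
  apply le_antisymm
  · refine le_iInf fun x => ?_
    rw [minCostLe, minCostLe, minCostLe, ENNReal.sInf_add]
    refine le_iInf₂ ?_
    rintro _ ⟨q, hqs, hqx, hqm, rfl⟩
    rw [ENNReal.add_sInf]
    refine le_iInf₂ ?_
    rintro _ ⟨r, hrx, hrg, hrn, rfl⟩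
    obtain ⟨u, rfl⟩ := List.getLast?_eq_some_iff.mp hqx
    obtain ⟨t, rfl⟩ := List.head?_eq_some_iff.mp hrx
    rw [← pathCost_append_cons]
    refine minCostLe_le_pathCost c ?_ ?_ ?_
    · cases u <;> simpa using hqs
    · simpa using hrg
    · simp at hqm hrn ⊢
      omega
  · refine le_sInf ?_
    rintro _ ⟨p, hs, hg, hp, rfl⟩
    obtain ⟨x, q, r, hqs, hqx, hqm, hrx, hrg, hrn, hc⟩ := exists_split_path c n g m s p hs hg hp
    rw [← hc]
    exact (iInf_le _ x).trans
      (add_le_add (minCostLe_le_pathCost c hqs hqx hqm) (minCostLe_le_pathCost c hrx hrg hrn))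

theorem minCostLe_self {S : Type*} (c : S → S → ℝ≥0∞) (n : ℕ) (s : S) :
    minCostLe c n s s = 0 :=
  le_antisymm (minCostLe_le_pathCost c (p := [s]) rfl rfl (by simp)) zero_le

theorem minCostLe_one {S : Type*} (c : S → S → ℝ≥0∞) {s g : S} (h : s ≠ g) :
    minCostLe c 1 s g = c s g := by
  apply le_antisymm
  · simpa [pathCost] using minCostLe_le_pathCost c (n := 1) (p := [s, g]) rfl rfl (by simp)
  · refine le_sInf ?_
    rintro _ ⟨p, hs, hg, hp, rfl⟩
    match p with
    | [] => simp at hs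
    | [a] =>
      simp only [List.head?_cons, List.getLast?_singleton, Option.some.injEq] at hs hg
      exact absurd (hs.symm.trans hg) h
    | [a, b] =>
      simp at hs hg
      simp [pathCost, hs, hg]
    | _ :: _ :: _ :: _ => simp at hp

/-- If `V_0(s,s') = c(s,s')` for `s ≠ s'`, `V_k(s,s) = 0`, and
`V_k(s,s') = min_{s_m} (V_{k-1}(s,s_m) + V_{k-1}(s_m,s'))` for `s ≠ s'`, then `V_k(s,s')`
is the infimum of the costs of paths from `s` to `s'` using at most `2^k` edges. -/
theorem sgtdp_value_eq_min_cost_le {S : Type*} [Fintype S] [Nonempty S]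
    (c : S → S → ℝ≥0∞) (hdiag : ∀ s : S, c s s = 0)
    (V : ℕ → S → S → ℝ≥0∞)
    (hV0 : ∀ s s' : S, s ≠ s' → V 0 s s' = c s s')
    (hVdiag : ∀ (k : ℕ) (s : S), V k s s = 0)
    (hVrec : ∀ (k : ℕ) (s s' : S), s ≠ s' →
      V (k + 1) s s' = ⨅ m : S, (V k s m + V k m s')) :
    ∀ (k : ℕ) (s s' : S), V k s s' = minCostLe c (2 ^ k) s s' := by
  intro k
  induction k with
  | zero =>
    intro s s'
    rcases eq_or_ne s s' with rfl | h
    · rw [hVdiag, minCostLe_self]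
    · rw [hV0 s s' h, pow_zero, minCostLe_one c h]
  | succ k ih =>
    intro s s'
    rcases eq_or_ne s s' with rfl | h
    · rw [hVdiag, minCostLe_self]
    · rw [hVrec k s s' h, pow_succ, mul_two, minCostLe_add]
      simp only [ih]
end
end

section
/- Let V̂_0, …, V̂_K be an ε-approximate SGTDP sequence. Then for every k with 1 ≤ k ≤ K, ‖V̂_k − T^k V_0‖∞ ≤ (2^{k+1} − 1)·ε, where T^k V_0 denotes k applications of the SGTDP operator T to V_0. -/
noncomputable section

/-- The SGTDP operator: `(TV)(s,s') = min over s_m of (V(s, s_m) + V(s_m, s'))`. -/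
def sgtOp {S : Type*} [Fintype S] [Nonempty S] (V : S → S → ℝ) : S → S → ℝ :=
  fun s g => Finset.univ.inf' Finset.univ_nonempty fun m => V s m + V m g

theorem sgtOp_le_add {S : Type*} [Fintype S] [Nonempty S] {V W : S → S → ℝ} {a : ℝ}
    (h : ∀ s s' : S, V s s' ≤ W s s' + a) (s s' : S) :
    sgtOp V s s' ≤ sgtOp W s s' + 2 * a := by
  obtain ⟨m, -, hm⟩ := Finset.exists_mem_eq_inf' (Finset.univ_nonempty (α := S))
    fun m => W s m + W m s'
  have hV : sgtOp V s s' ≤ V s m + V m s' := Finset.inf'_le _ (Finset.mem_univ m)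
  have hW : sgtOp W s s' = W s m + W m s' := hm
  linarith [h s m, h m s']

theorem abs_sgtOp_sub_sgtOp_le {S : Type*} [Fintype S] [Nonempty S] {V W : S → S → ℝ} {a : ℝ}
    (h : ∀ s s' : S, |V s s' - W s s'| ≤ a) (s s' : S) :
    |sgtOp V s s' - sgtOp W s s'| ≤ 2 * a := by
  have h₁ := sgtOp_le_add (V := V) (W := W) (a := a)
    (fun x y => by linarith [(abs_le.mp (h x y)).2]) s s'
  have h₂ := sgtOp_le_add (V := W) (W := V) (a := a)
    (fun x y => by linarith [(abs_le.mp (h x y)).1]) s s'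
  exact abs_le.mpr ⟨by linarith, by linarith⟩

/-- Let `V̂_0, …, V̂_K` be an `ε`-approximate SGTDP sequence (pointwise
`|V̂_0 − c| ≤ ε` and `|V̂_{k+1} − T V̂_k| ≤ ε` for `k < K`). Then for every `1 ≤ k ≤ K`,
`‖V̂_k − T^k V_0‖∞ ≤ (2^{k+1} − 1)·ε`, where `V_0 = c`. -/
theorem approx_sgtdp_error_propagation {S : Type*} [Fintype S] [Nonempty S]
    (c : S → S → ℝ) (hcnn : ∀ s s' : S, 0 ≤ c s s') (hdiag : ∀ s : S, c s s = 0)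
    (ε : ℝ) (hε : 0 ≤ ε) (K : ℕ) (Vhat : ℕ → S → S → ℝ)
    (h0 : ∀ s s' : S, |Vhat 0 s s' - c s s'| ≤ ε)
    (hstep : ∀ k : ℕ, k < K → ∀ s s' : S,
      |Vhat (k + 1) s s' - sgtOp (Vhat k) s s'| ≤ ε) :
    ∀ k : ℕ, 1 ≤ k → k ≤ K → ∀ s s' : S,
      |Vhat k s s' - (sgtOp^[k] c) s s'| ≤ (2 ^ (k + 1) - 1) * ε := by
  suffices h : ∀ k : ℕ, k ≤ K → ∀ s s' : S,
      |Vhat k s s' - (sgtOp^[k] c) s s'| ≤ (2 ^ (k + 1) - 1) * ε from fun k _ => h k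
  intro k
  induction k with
  | zero =>
    intro _ s s'
    norm_num
    exact h0 s s'
  | succ k ih =>
    intro hk s s'
    rw [Function.iterate_succ_apply']
    calc _ ≤ _ := abs_sub_le _ (sgtOp (Vhat k) s s') _
      _ ≤ ε + 2 * ((2 ^ (k + 1) - 1) * ε) :=
        add_le_add (hstep k (by omega) s s') (abs_sgtOp_sub_sgtOp_le (ih (by omega)) s s')
      _ = (2 ^ (k + 1 + 1) - 1) * ε := by ring
end
end

section
/- Let the graph have N = 2^K vertices for an integer K ≥ 0, and let V̂_0, …, V̂_K be an ε-approximate SGTDP sequence. Then ‖V̂_K − V*‖∞ ≤ ε·(2N − 1), where V*(s,s') is the minimum cost of a path from s to s' (equivalently V* = T^K V_0). -/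
noncomputable section

/-- The cost of a path given as a list of visited vertices:
the sum of edge costs of consecutive vertices. A path with 0 edges has cost 0. -/
def pathCostR {S : Type*} (c : S → S → ℝ) : List S → ℝ
  | [] => 0
  | [_] => 0
  | a :: b :: rest => c a b + pathCostR c (b :: rest)

/-- `V*(s,g)`: the minimum (infimum) cost over all paths from `s` to `g`. -/
def VstarR {S : Type*} (c : S → S → ℝ) (s g : S) : ℝ :=
  sInf {x | ∃ p : List S, p.head? = some s ∧ p.getLast? = some g ∧ pathCostR c p = x}

theorem pathCostR_nonneg {S : Type*} {c : S → S → ℝ} (hc : ∀ s s' : S, 0 ≤ c s s') :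
    ∀ p : List S, 0 ≤ pathCostR c p
  | [] => le_rfl
  | [_] => le_rfl
  | a :: b :: rest => add_nonneg (hc a b) (pathCostR_nonneg hc (b :: rest))

theorem pathCostR_append_cons {S : Type*} (c : S → S → ℝ) (m : S) (b : List S) :
    ∀ a : List S,
      pathCostR c (a ++ m :: b) = pathCostR c (a ++ [m]) + pathCostR c (m :: b)
  | [] => by simp [pathCostR]
  | [x] => by simp [pathCostR]
  | x :: y :: a => by
    have h := pathCostR_append_cons c m b (y :: a)
    simp only [List.cons_append, pathCostR] at h ⊢
    rw [h, add_assoc]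

theorem pathCostR_le_cons {S : Type*} {c : S → S → ℝ} (hc : ∀ s s' : S, 0 ≤ c s s')
    (x : S) : ∀ p : List S, pathCostR c p ≤ pathCostR c (x :: p)
  | [] => le_rfl
  | y :: _ => le_add_of_nonneg_left (hc x y)

/-- Removing cycles: every path can be replaced by a simple path of no larger cost. -/
theorem exists_nodup_pathCostR_le {S : Type*} {c : S → S → ℝ}
    (hc : ∀ s s' : S, 0 ≤ c s s') (p : List S) :
    ∃ q : List S, q.Nodup ∧ q.head? = p.head? ∧ q.getLast? = p.getLast? ∧
      pathCostR c q ≤ pathCostR c p := by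
  induction p with
  | nil => exact ⟨[], by simp⟩
  | cons x p ih =>
    obtain ⟨q, hnd, hh, hl, hcost⟩ := ih
    by_cases hx : x ∈ q
    · obtain ⟨a, b, rfl⟩ := List.append_of_mem hx
      refine ⟨x :: b, hnd.of_append_right, rfl, ?_, ?_⟩
      · rw [List.getLast?_cons (l := p), ← hl]
        simp [List.getLast?_append, List.getLast?_cons]
      · have h1 := pathCostR_append_cons c x b a
        have h2 := pathCostR_nonneg hc (a ++ [x])
        have h3 := pathCostR_le_cons hc x p
        linarith
    · refine ⟨x :: q, List.nodup_cons.2 ⟨hx, hnd⟩, rfl, ?_, ?_⟩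
      · rw [List.getLast?_cons, List.getLast?_cons, hl]
      · cases q with
        | nil =>
          cases p with
          | nil => exact le_rfl
          | cons z p => simp at hh
        | cons y q =>
          cases p with
          | nil => simp at hh
          | cons z p =>
            obtain rfl : y = z := by simpa using hh
            exact add_le_add le_rfl hcost

theorem exists_eq_append_cons_length_le {S : Type*} (n : ℕ) (p : List S) (hp : p ≠ [])
    (hlen : p.length ≤ 2 * n + 1) :
    ∃ a m b, p = a ++ m :: b ∧ a.length ≤ n ∧ b.length ≤ n := by
  have hpos := List.length_pos_iff.2 hp
  have hi : min n (p.length - 1) < p.length := by omega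
  refine ⟨p.take (min n (p.length - 1)), p[min n (p.length - 1)],
    p.drop (min n (p.length - 1) + 1), ?_, ?_, ?_⟩
  · rw [← List.drop_eq_getElem_cons hi, List.take_append_drop]
  · rw [List.length_take]; omega
  · rw [List.length_drop]; omega

/-- The accumulated error of `k` approximate SGTDP steps, against paths with at most
`2 ^ k` edges. -/
theorem approx_sgtdp_le_pathCostR {S : Type*} [Fintype S] [Nonempty S] {K : ℕ}
    {c : S → S → ℝ} (hdiag : ∀ s : S, c s s = 0) {ε : ℝ} {Vhat : ℕ → S → S → ℝ}
    (h0 : ∀ s s' : S, |Vhat 0 s s' - c s s'| ≤ ε)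
    (hstep : ∀ k : ℕ, k < K → ∀ s s' : S,
      |Vhat (k + 1) s s' - sgtOp (Vhat k) s s'| ≤ ε) (k : ℕ) (hk : k ≤ K) :
    ∀ (s g : S) (p : List S), p.head? = some s → p.getLast? = some g →
      p.length ≤ 2 ^ k + 1 → Vhat k s g ≤ pathCostR c p + ε * (2 * 2 ^ k - 1) := by
  induction k with
  | zero =>
    intro s g p hs hg hlen
    have h := (abs_le.1 (h0 s g)).2
    match p, hs, hg, hlen with
    | [x], hs, hg, _ =>
      obtain rfl : x = s := by simpa using hs
      obtain rfl : x = g := by simpa using hg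
      rw [hdiag] at h
      simp only [pathCostR]
      linarith
    | [x, y], hs, hg, _ =>
      obtain rfl : x = s := by simpa using hs
      obtain rfl : y = g := by simpa using hg
      simp only [pathCostR]
      linarith
    | _ :: _ :: _ :: _, _, _, hlen => simp at hlen
  | succ k ih =>
    intro s g p hs hg hlen
    obtain ⟨a, m, b, rfl, ha, hb⟩ := exists_eq_append_cons_length_le (2 ^ k) p
      (by rintro rfl; simp at hs) (by rw [pow_succ] at hlen; omega)
    have h1 := ih (by omega) s m (a ++ [m]) (by simpa [List.head?_append] using hs)
      (by simp) (by simpa using ha)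
    have h2 := ih (by omega) m g (m :: b) rfl
      (by simpa [List.getLast?_append, List.getLast?_cons] using hg) (by simpa using hb)
    have h3 : sgtOp (Vhat k) s g ≤ Vhat k s m + Vhat k m g :=
      Finset.inf'_le (fun m => Vhat k s m + Vhat k m g) (Finset.mem_univ m)
    have h4 := (abs_le.1 (hstep k (by omega) s g)).2
    rw [pathCostR_append_cons, pow_succ]
    linarith

theorem exists_pathCostR_le_approx_sgtdp {S : Type*} [Fintype S] [Nonempty S] {K : ℕ}
    {c : S → S → ℝ} {ε : ℝ} {Vhat : ℕ → S → S → ℝ}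
    (h0 : ∀ s s' : S, |Vhat 0 s s' - c s s'| ≤ ε)
    (hstep : ∀ k : ℕ, k < K → ∀ s s' : S,
      |Vhat (k + 1) s s' - sgtOp (Vhat k) s s'| ≤ ε) (k : ℕ) (hk : k ≤ K) :
    ∀ s g : S, ∃ p : List S, p.head? = some s ∧ p.getLast? = some g ∧
      pathCostR c p ≤ Vhat k s g + ε * (2 * 2 ^ k - 1) := by
  induction k with
  | zero =>
    intro s g
    have h := (abs_le.1 (h0 s g)).1
    refine ⟨[s, g], rfl, rfl, ?_⟩
    simp only [pathCostR]
    linarith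
  | succ k ih =>
    intro s g
    obtain ⟨m, -, hm⟩ := Finset.exists_mem_eq_inf' Finset.univ_nonempty
      (fun m => Vhat k s m + Vhat k m g)
    obtain ⟨p, hps, hpm, hp⟩ := ih (by omega) s m
    obtain ⟨q, hqm, hqg, hq⟩ := ih (by omega) m g
    obtain ⟨a, rfl⟩ := List.getLast?_eq_some_iff.1 hpm
    obtain ⟨b, rfl⟩ := List.head?_eq_some_iff.1 hqm
    refine ⟨a ++ m :: b, by simpa [List.head?_append] using hps,
      by simpa [List.getLast?_append, List.getLast?_cons] using hqg, ?_⟩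
    have h := (abs_le.1 (hstep k (by omega) s g)).1
    have h' : sgtOp (Vhat k) s g = Vhat k s m + Vhat k m g := hm
    rw [pathCostR_append_cons, pow_succ]
    linarith

/-- If the graph has `N = 2^K` vertices and `V̂_0, …, V̂_K` is an
`ε`-approximate SGTDP sequence, then `‖V̂_K − V*‖∞ ≤ ε·(2N − 1)`. -/
theorem approx_sgtdp_final_error {S : Type*} [Fintype S] [Nonempty S]
    (K N : ℕ) (hNK : N = 2 ^ K) (hcard : Fintype.card S = N)
    (c : S → S → ℝ) (hcnn : ∀ s s' : S, 0 ≤ c s s') (hdiag : ∀ s : S, c s s = 0)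
    (ε : ℝ) (hε : 0 ≤ ε) (Vhat : ℕ → S → S → ℝ)
    (h0 : ∀ s s' : S, |Vhat 0 s s' - c s s'| ≤ ε)
    (hstep : ∀ k : ℕ, k < K → ∀ s s' : S,
      |Vhat (k + 1) s s' - sgtOp (Vhat k) s s'| ≤ ε) :
    ∀ s s' : S, |Vhat K s s' - VstarR c s s'| ≤ ε * (2 * (N : ℝ) - 1) := by
  intro s s'
  have hN : (N : ℝ) = 2 ^ K := by rw [hNK]; push_cast; rfl
  rw [hN]
  obtain ⟨p, hps, hpg, hp⟩ := exists_pathCostR_le_approx_sgtdp h0 hstep K le_rfl s s'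
  have hlow : VstarR c s s' ≤ pathCostR c p :=
    csInf_le ⟨0, by rintro _ ⟨q, -, -, rfl⟩; exact pathCostR_nonneg hcnn q⟩
      ⟨p, hps, hpg, rfl⟩
  have hup : Vhat K s s' - ε * (2 * 2 ^ K - 1) ≤ VstarR c s s' := by
    refine le_csInf ⟨_, p, hps, hpg, rfl⟩ ?_
    rintro _ ⟨q, hqs, hqg, rfl⟩
    obtain ⟨r, hnd, hr, hr', hle⟩ := exists_nodup_pathCostR_le hcnn q
    have hlen : r.length ≤ 2 ^ K + 1 := by
      have := hnd.length_le_card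
      omega
    have := approx_sgtdp_le_pathCostR hdiag h0 hstep K le_rfl s s' r (hr.trans hqs)
      (hr'.trans hqg) hlen
    linarith
  exact abs_le.2 ⟨by linarith, by linarith⟩
end
end

section
/- (Sub-goal tree policy gradient theorem.) Let π_θ be a parametrized stochastic SGT policy with trajectory distribution Pr_θ over S^{T+1}, T = 2^D, and let J(θ) = Σ_{τ ∈ S^{T+1}} c_τ · Pr_θ[τ]. Then J is differentiable and for every θ ∈ ℝ^n: ∇_θ J(θ) = Σ_{τ} Pr_θ[τ] · c_τ · ∇_θ log Pr_θ[τ] = Σ_{τ} Pr_θ[τ] · Σ_{d=1}^{D} Σ_{i=1}^{2^{D−d}} C_τ^{i,d} · ∇_θ log π_θ( s_m^{i,d} | s^{i,d}, g^{i,d} ). Moreover, for any fixed function b : S × S → ℝ, the same identity holds with C_τ^{i,d} replaced by C_τ^{i,d} − b( s^{i,d}, g^{i,d} ). -/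
noncomputable section

/-- Recursively defined sub-goal tree likelihood of the segment of the trajectory `τ`
starting at index `a` and spanning `2^k` steps. `π θ s g m` denotes `π_θ(m | s, g)`. -/
def segLik {E S : Type*} (π : E → S → S → S → ℝ) (θ : E) (τ : ℕ → S) :
    ℕ → ℕ → ℝ
  | _, 0 => 1
  | a, k + 1 =>
      π θ (τ a) (τ (a + 2 ^ (k + 1))) (τ (a + 2 ^ k)) *
        segLik π θ τ a k * segLik π θ τ (a + 2 ^ k) k

/-- View a trajectory `τ ∈ S^{T+1}` as a function on `ℕ` (indices beyond `T` are clamped). -/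
def liftT {S : Type*} {T : ℕ} (τ : Fin (T + 1) → S) (t : ℕ) : S :=
  τ ⟨min t T, by omega⟩

/-- The probability of a trajectory `τ ∈ S^{T+1}`, `T = 2^D`:
`Pr_θ[τ] = ρ₀(s_0, s_T) · Pr_θ[τ | s_0, s_T]`. -/
def trajProb {E S : Type*} (ρ₀ : S → S → ℝ) (π : E → S → S → S → ℝ) (D : ℕ)
    (θ : E) (τ : Fin (2 ^ D + 1) → S) : ℝ :=
  ρ₀ (liftT τ 0) (liftT τ (2 ^ D)) * segLik π θ (liftT τ) 0 D

/-- `c_{a:b}(τ) = Σ_{t=a}^{b−1} c(s_t, s_{t+1})`: the cost of the sub-trajectory of `τ`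
from index `a` to index `b`. -/
def segCost {S : Type*} (c : S → S → ℝ) {T : ℕ} (τ : Fin (T + 1) → S) (a b : ℕ) : ℝ :=
  ∑ t ∈ Finset.Ico a b, c (liftT τ t) (liftT τ (t + 1))

lemma sum_Icc_one_eq_sum_range {V : Type*} [AddCommMonoid V] (f : ℕ → V) (N : ℕ) :
    ∑ i ∈ Finset.Icc 1 N, f i = ∑ j ∈ Finset.range N, f (j + 1) := by
  induction N with
  | zero => simp
  | succ N ih => rw [Finset.sum_Icc_succ_top (by omega), ih, Finset.sum_range_succ]

section Gradient

variable {F : Type*} [NormedAddCommGroup F] [InnerProductSpace ℝ F] [CompleteSpace F]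

lemma gradient_fun_sum {ι : Type*} (u : Finset ι) {f : ι → F → ℝ} {x : F}
    (h : ∀ i ∈ u, DifferentiableAt ℝ (f i) x) :
    gradient (fun y => ∑ i ∈ u, f i y) x = ∑ i ∈ u, gradient (f i) x := by
  simp only [gradient, fderiv_fun_sum h, map_sum]

lemma gradient_fun_const_mul {f : F → ℝ} {x : F} (h : DifferentiableAt ℝ f x) (a : ℝ) :
    gradient (fun y => a * f y) x = a • gradient f x := by
  simp only [gradient, fderiv_const_mul h, map_smulₛₗ]
  simp

lemma gradient_fun_const_add (f : F → ℝ) (x : F) (a : ℝ) :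
    gradient (fun y => a + f y) x = gradient f x := by
  simp only [gradient, fderiv_const_add]

lemma smul_gradient_log {f : F → ℝ} {x : F} (h : DifferentiableAt ℝ f x) (hx : f x ≠ 0) :
    f x • gradient (fun y => Real.log (f y)) x = gradient f x := by
  simp only [gradient, fderiv.log h hx, map_smulₛₗ]
  simp [smul_smul, hx]

end Gradient

section Likelihood

variable {E S : Type*} {π : E → S → S → S → ℝ}

lemma segLik_pos (hpos : ∀ θ s g m, 0 < π θ s g m) (θ : E) (x : ℕ → S) (a k : ℕ) :
    0 < segLik π θ x a k := by
  induction k generalizing a with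
  | zero => simp [segLik]
  | succ k ih => exact mul_pos (mul_pos (hpos _ _ _ _) (ih _)) (ih _)

lemma differentiable_segLik [NormedAddCommGroup E] [NormedSpace ℝ E]
    (hdiff : ∀ s g m, Differentiable ℝ fun θ => π θ s g m) (x : ℕ → S) (a k : ℕ) :
    Differentiable ℝ fun θ => segLik π θ x a k := by
  induction k generalizing a with
  | zero => simp [segLik]
  | succ k ih => exact ((hdiff _ _ _).mul (ih _)).mul (ih _)

lemma segLik_dependsOn (π : E → S → S → S → ℝ) (θ : E) (a k : ℕ) :
    DependsOn (fun x => segLik π θ x a k) (Set.Icc a (a + 2 ^ k)) := by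
  induction k generalizing a with
  | zero => intro x y _; rfl
  | succ k ih =>
    intro x y h
    have hk : 0 < 2 ^ k := Nat.two_pow_pos k
    have h2 : 2 ^ (k + 1) = 2 ^ k + 2 ^ k := by ring
    have hl := ih a fun t ht => h t ⟨ht.1, by have := ht.2; omega⟩
    have hr := ih (a + 2 ^ k) fun t ht => h t ⟨by have := ht.1; omega, by have := ht.2; omega⟩
    simp only [segLik] at hl hr ⊢
    rw [hl, hr, h a ⟨le_rfl, by omega⟩, h (a + 2 ^ k) ⟨by omega, by omega⟩,
      h (a + 2 ^ (k + 1)) ⟨by omega, le_rfl⟩]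

/-- The likelihood of a segment factors through the likelihood of any dyadic sub-segment, the
other factor not depending on the interior of the sub-segment. -/
lemma exists_segLik_eq_mul (π : E → S → S → S → ℝ) (θ : E) (k e a i : ℕ) (hi : i < 2 ^ e) :
    ∃ R : (ℕ → S) → ℝ,
      DependsOn R (Set.Ioo (a + i * 2 ^ k) (a + i * 2 ^ k + 2 ^ k))ᶜ ∧
      ∀ x, segLik π θ x a (k + e) = R x * segLik π θ x (a + i * 2 ^ k) k := by
  induction e generalizing a i with
  | zero =>
    obtain rfl : i = 0 := by simpa using hi
    exact ⟨fun _ => 1, fun _ _ _ => rfl, fun x => by simp⟩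
  | succ e ih =>
    have h2 : 2 ^ (k + e + 1) = 2 ^ (k + e) + 2 ^ (k + e) := by ring
    have hke : 2 ^ (k + e) = 2 ^ e * 2 ^ k := by ring
    have hk : 0 < 2 ^ k := Nat.two_pow_pos k
    rcases lt_or_ge i (2 ^ e) with hlt | hge
    · obtain ⟨R, hR, hfac⟩ := ih a i hlt
      have hle : i * 2 ^ k + 2 ^ k ≤ 2 ^ (k + e) := by
        rw [hke, ← Nat.succ_mul]; exact Nat.mul_le_mul_right _ hlt
      refine ⟨fun x => π θ (x a) (x (a + 2 ^ (k + e + 1))) (x (a + 2 ^ (k + e))) * R x *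
        segLik π θ x (a + 2 ^ (k + e)) (k + e), ?_, ?_⟩
      · intro x y h
        have hr := segLik_dependsOn π θ (a + 2 ^ (k + e)) (k + e) (x := x) (y := y)
          fun t ht => h t fun ht' => by have := ht.1; have := ht'.2; omega
        simp only at hr ⊢
        rw [hR h, hr, h a fun ht => by have := ht.1; omega,
          h (a + 2 ^ (k + e)) fun ht => by have := ht.2; omega,
          h (a + 2 ^ (k + e + 1)) fun ht => by have := ht.2; omega]
      · intro x
        rw [← add_assoc, segLik, hfac]
        ring
    · obtain ⟨j, rfl⟩ := Nat.exists_eq_add_of_le hge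
      have hj : j < 2 ^ e := by rw [pow_succ] at hi; omega
      obtain ⟨R, hR, hfac⟩ := ih (a + 2 ^ (k + e)) j hj
      have hle : j * 2 ^ k + 2 ^ k ≤ 2 ^ (k + e) := by
        rw [hke, ← Nat.succ_mul]; exact Nat.mul_le_mul_right _ hj
      have hidx : a + (2 ^ e + j) * 2 ^ k = a + 2 ^ (k + e) + j * 2 ^ k := by rw [hke]; ring
      rw [hidx]
      refine ⟨fun x => π θ (x a) (x (a + 2 ^ (k + e + 1))) (x (a + 2 ^ (k + e))) *
        segLik π θ x a (k + e) * R x, ?_, ?_⟩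
      · intro x y h
        have hl := segLik_dependsOn π θ a (k + e) (x := x) (y := y)
          fun t ht => h t fun ht' => by have := ht.2; have := ht'.1; omega
        simp only at hl ⊢
        rw [hR h, hl, h a fun ht => by have := ht.1; omega,
          h (a + 2 ^ (k + e)) fun ht => by have := ht.1; omega,
          h (a + 2 ^ (k + e + 1)) fun ht => by have := ht.2; omega]
      · intro x
        rw [← add_assoc, segLik, hfac]
        ring

lemma log_segLik (hpos : ∀ θ s g m, 0 < π θ s g m) (θ : E) (x : ℕ → S) (a k : ℕ) :
    Real.log (segLik π θ x a k) =
      ∑ e ∈ Finset.range k, ∑ j ∈ Finset.range (2 ^ (k - (e + 1))),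
        Real.log (π θ (x (a + j * 2 ^ (e + 1))) (x (a + (j + 1) * 2 ^ (e + 1)))
          (x (a + (2 * j + 1) * 2 ^ e))) := by
  induction k generalizing a with
  | zero => simp [segLik]
  | succ k ih =>
    have hsplit : ∀ e ∈ Finset.range k,
        2 ^ (k + 1 - (e + 1)) = 2 ^ (k - (e + 1)) + 2 ^ (k - (e + 1)) := by
      intro e he
      have := Finset.mem_range.mp he
      rw [show k + 1 - (e + 1) = k - (e + 1) + 1 by omega]
      ring
    have hstep : ∀ e ∈ Finset.range k, 2 ^ k = 2 ^ (k - (e + 1)) * 2 ^ (e + 1) := by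
      intro e he
      have := Finset.mem_range.mp he
      rw [← pow_add]
      congr 1
      omega
    have hl := (segLik_pos hpos θ x a k).ne'
    have hr := (segLik_pos hpos θ x (a + 2 ^ k) k).ne'
    have hn := (hpos θ (x a) (x (a + 2 ^ (k + 1))) (x (a + 2 ^ k))).ne'
    rw [segLik, Real.log_mul (mul_ne_zero hn hl) hr, Real.log_mul hn hl, ih, ih,
      Finset.sum_range_succ, add_assoc, ← Finset.sum_add_distrib, add_comm]
    congr 1
    · refine Finset.sum_congr rfl fun e he => ?_
      rw [hsplit e he, Finset.sum_range_add]
      congr 1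
      refine Finset.sum_congr rfl fun j _ => ?_
      rw [hstep e he]
      congr 3 <;> ring
    · simp

end Likelihood

section Trajectory

variable {S : Type*}

lemma liftT_update {T : ℕ} (τ : Fin (T + 1) → S) {j : ℕ} (hj : j < T) (m : S) :
    liftT (Function.update τ ⟨j, by omega⟩ m) = Function.update (liftT τ) j m := by
  funext t
  simp only [liftT, Function.update_apply, Fin.mk.injEq]
  congr 1
  simp only [eq_iff_iff]
  omega

lemma DependsOn.apply_update {V : Type*} {F : (ℕ → S) → V} {s : Set ℕ} (hF : DependsOn F sᶜ) {j : ℕ}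
    (hj : j ∈ s) (x : ℕ → S) (m : S) : F (Function.update x j m) = F x :=
  hF fun t ht => Function.update_of_ne (fun h => ht (by rwa [h])) _ _

variable [Fintype S]

lemma sum_sum_update {ι V : Type*} [Fintype ι] [DecidableEq ι] [AddCommMonoid V]
    (j : ι) (G : (ι → S) → V) :
    ∑ τ : ι → S, ∑ m : S, G (Function.update τ j m) = Fintype.card S • ∑ τ : ι → S, G τ := by
  have hinv : Function.Involutive
      fun p : (ι → S) × S => (Function.update p.1 j p.2, p.1 j) := by
    intro p
    simp
  rw [← Fintype.sum_prod_type' fun τ m => G (Function.update τ j m),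
    ← Equiv.sum_comp hinv.toPerm, Fintype.sum_prod_type]
  simp [Finset.smul_sum]

variable {E V : Type*} [AddCommGroup V] [Module ℝ V] {T : ℕ} {π : E → S → S → S → ℝ}

lemma sum_segLik_succ_children_smul {θ : E} {k : ℕ} {C : ℝ}
    (hC : ∀ (a : ℕ) (F : (ℕ → S) → V), a + 2 ^ k ≤ T → DependsOn F (Set.Ioo a (a + 2 ^ k))ᶜ →
      ∑ τ : Fin (T + 1) → S, segLik π θ (liftT τ) a k • F (liftT τ) =
        C • ∑ τ : Fin (T + 1) → S, F (liftT τ))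
    {a : ℕ} (ha : a + 2 ^ (k + 1) ≤ T) {F : (ℕ → S) → V}
    (hF : DependsOn F (Set.Ioo a (a + 2 ^ k) ∪ Set.Ioo (a + 2 ^ k) (a + 2 ^ (k + 1)))ᶜ) :
    ∑ τ : Fin (T + 1) → S, (segLik π θ (liftT τ) a k * segLik π θ (liftT τ) (a + 2 ^ k) k) •
        F (liftT τ) =
      (C * C) • ∑ τ : Fin (T + 1) → S, F (liftT τ) := by
  have h2 : a + 2 ^ (k + 1) = a + 2 ^ k + 2 ^ k := by ring
  have hk : 0 < 2 ^ k := Nat.two_pow_pos k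
  rw [h2] at hF ha
  have hl : DependsOn (fun x => segLik π θ x (a + 2 ^ k) k • F x) (Set.Ioo a (a + 2 ^ k))ᶜ := by
    intro x y h
    have hr := segLik_dependsOn π θ (a + 2 ^ k) k (x := x) (y := y)
      fun t ht => h t fun ht' => by have := ht.1; have := ht'.2; omega
    simp only at hr ⊢
    rw [hr, hF fun t ht => h t fun ht' => ht (Or.inl ht')]
  simp only [mul_smul]
  rw [hC a (fun x => segLik π θ x (a + 2 ^ k) k • F x) (by omega) hl,
    hC (a + 2 ^ k) F ha (hF.mono (Set.compl_subset_compl.mpr Set.subset_union_right))]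

variable [Nonempty S]

lemma sum_liftT_eq_sum_update {j : ℕ} (hj : j < T) (F : (ℕ → S) → V) :
    ∑ τ : Fin (T + 1) → S, F (liftT τ) =
      (Fintype.card S : ℝ)⁻¹ •
        ∑ τ : Fin (T + 1) → S, ∑ m : S, F (Function.update (liftT τ) j m) := by
  have h := sum_sum_update (⟨j, by omega⟩ : Fin (T + 1)) fun τ : Fin (T + 1) → S => F (liftT τ)
  simp only [liftT_update _ hj] at h
  rw [h, ← Nat.cast_smul_eq_nsmul ℝ, inv_smul_smul₀]
  exact_mod_cast Fintype.card_ne_zero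

lemma sum_node_smul {w : S → S → S → ℝ} {r : ℝ} (hw : ∀ s g, ∑ m, w s g m = r)
    {a j b : ℕ} (haj : a < j) (hjb : j < b) (hb : b ≤ T) {F : (ℕ → S) → V}
    (hF : DependsOn F (Set.Ioo a b)ᶜ) :
    ∑ τ : Fin (T + 1) → S, w (liftT τ a) (liftT τ b) (liftT τ j) • F (liftT τ) =
      (r * (Fintype.card S : ℝ)⁻¹) • ∑ τ : Fin (T + 1) → S, F (liftT τ) := by
  rw [sum_liftT_eq_sum_update (hjb.trans_le hb)
    fun x => w (x a) (x b) (x j) • F x]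
  simp only [hF.apply_update ⟨haj, hjb⟩, Function.update_self, Function.update_of_ne haj.ne,
    Function.update_of_ne hjb.ne', ← Finset.sum_smul, hw, ← Finset.smul_sum, smul_smul]
  rw [mul_comm]

/-- Summing the likelihood of a segment over its interior yields a constant. -/
lemma exists_sum_segLik_smul (V : Type*) [AddCommGroup V] [Module ℝ V] (T : ℕ)
    (hpmf : ∀ θ s g, ∑ m, π θ s g m = 1) (θ : E) (k : ℕ) :
    ∃ C : ℝ, ∀ (a : ℕ) (F : (ℕ → S) → V), a + 2 ^ k ≤ T →
      DependsOn F (Set.Ioo a (a + 2 ^ k))ᶜ →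
      ∑ τ : Fin (T + 1) → S, segLik π θ (liftT τ) a k • F (liftT τ) =
        C • ∑ τ : Fin (T + 1) → S, F (liftT τ) := by
  induction k with
  | zero => exact ⟨1, fun a F _ _ => by simp [segLik]⟩
  | succ k ih =>
    obtain ⟨C, hC⟩ := ih
    refine ⟨C * C * (1 * (Fintype.card S : ℝ)⁻¹), fun a F ha hF => ?_⟩
    have hk : 0 < 2 ^ k := Nat.two_pow_pos k
    have h2 : 2 ^ (k + 1) = 2 ^ k + 2 ^ k := by ring
    have hnode : DependsOn
        (fun x : ℕ → S => π θ (x a) (x (a + 2 ^ (k + 1))) (x (a + 2 ^ k)) • F x)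
        (Set.Ioo a (a + 2 ^ k) ∪ Set.Ioo (a + 2 ^ k) (a + 2 ^ (k + 1)))ᶜ := by
      intro x y h
      have hmem : ∀ t, t ∉ Set.Ioo a (a + 2 ^ k) ∪ Set.Ioo (a + 2 ^ k) (a + 2 ^ (k + 1)) →
        x t = y t := h
      simp only [Set.mem_union, Set.mem_Ioo] at hmem
      simp only
      rw [hmem a (by omega), hmem (a + 2 ^ k) (by omega), hmem (a + 2 ^ (k + 1)) (by omega),
        hF fun t ht => hmem t fun ht' => ht ⟨by omega, by omega⟩]
    have h := sum_segLik_succ_children_smul hC ha hnode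
    simp only [smul_smul] at h
    rw [mul_smul, ← sum_node_smul (hpmf θ) (j := a + 2 ^ k) (by omega) (by omega)
      ha hF]
    simp only [segLik]
    convert h using 3
    ring

end Trajectory

section Score

variable {S E : Type*} [NormedAddCommGroup E] [InnerProductSpace ℝ E] [CompleteSpace E]
  {π : E → S → S → S → ℝ}

lemma gradient_log_trajProb (hpos : ∀ θ s g m, 0 < π θ s g m)
    (hdiff : ∀ s g m, Differentiable ℝ fun θ => π θ s g m) {ρ₀ : S → S → ℝ}
    (hρ : ∀ s g, 0 < ρ₀ s g) (D : ℕ) (θ : E) (τ : Fin (2 ^ D + 1) → S) :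
    gradient (fun θ' => Real.log (trajProb ρ₀ π D θ' τ)) θ =
      ∑ k ∈ Finset.range D, ∑ j ∈ Finset.range (2 ^ (D - (k + 1))),
        gradient (fun θ' => Real.log (π θ' (liftT τ (j * 2 ^ (k + 1)))
          (liftT τ ((j + 1) * 2 ^ (k + 1))) (liftT τ ((2 * j + 1) * 2 ^ k)))) θ := by
  have hlog : ∀ s g m, DifferentiableAt ℝ (fun θ' => Real.log (π θ' s g m)) θ :=
    fun s g m => (hdiff s g m θ).log (hpos _ _ _ _).ne'
  simp only [trajProb, Real.log_mul (hρ _ _).ne' (segLik_pos hpos _ _ _ _).ne',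
    gradient_fun_const_add, log_segLik hpos, zero_add]
  rw [gradient_fun_sum _ fun k _ => DifferentiableAt.fun_sum fun j _ => hlog _ _ _]
  exact Finset.sum_congr rfl fun k _ => gradient_fun_sum _ fun j _ => hlog _ _ _

variable [Fintype S] [Nonempty S]

/-- The score of the root of a segment has mean zero, conditionally on the states outside of the
interior of the segment. -/
lemma sum_segLik_smul_gradient_log_eq_zero (hpos : ∀ θ s g m, 0 < π θ s g m)
    (hpmf : ∀ θ s g, ∑ m, π θ s g m = 1)
    (hdiff : ∀ s g m, Differentiable ℝ fun θ => π θ s g m) (θ : E) {T a k : ℕ}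
    (ha : a + 2 ^ (k + 1) ≤ T) {F : (ℕ → S) → ℝ}
    (hF : DependsOn F (Set.Ioo a (a + 2 ^ (k + 1)))ᶜ) :
    ∑ τ : Fin (T + 1) → S, (F (liftT τ) * segLik π θ (liftT τ) a (k + 1)) •
      gradient (fun θ' => Real.log
        (π θ' (liftT τ a) (liftT τ (a + 2 ^ (k + 1))) (liftT τ (a + 2 ^ k)))) θ = 0 := by
  have hk : 0 < 2 ^ k := Nat.two_pow_pos k
  have h2 : 2 ^ (k + 1) = 2 ^ k + 2 ^ k := by ring
  have hscore : ∀ s g, ∑ m, gradient (fun θ' => π θ' s g m) θ = 0 := by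
    intro s g
    rw [← gradient_fun_sum _ fun m _ => hdiff s g m θ]
    simp only [hpmf, gradient_fun_const]
  let G : (ℕ → S) → E := fun x =>
    F x • gradient (fun θ' => π θ' (x a) (x (a + 2 ^ (k + 1))) (x (a + 2 ^ k))) θ
  have hG : DependsOn G
      (Set.Ioo a (a + 2 ^ k) ∪ Set.Ioo (a + 2 ^ k) (a + 2 ^ (k + 1)))ᶜ := by
    intro x y h
    have hmem : ∀ t, t ∉ Set.Ioo a (a + 2 ^ k) ∪ Set.Ioo (a + 2 ^ k) (a + 2 ^ (k + 1)) →
      x t = y t := h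
    simp only [Set.mem_union, Set.mem_Ioo] at hmem
    simp only [G]
    rw [hmem a (by omega), hmem (a + 2 ^ k) (by omega), hmem (a + 2 ^ (k + 1)) (by omega),
      hF fun t ht => hmem t fun ht' => ht ⟨by omega, by omega⟩]
  have hsum : ∑ τ : Fin (T + 1) → S, G (liftT τ) = 0 := by
    rw [sum_liftT_eq_sum_update (j := a + 2 ^ k) (by omega)]
    have hj : a + 2 ^ k ∈ Set.Ioo a (a + 2 ^ (k + 1)) := ⟨by omega, by omega⟩
    simp only [G, hF.apply_update hj, Function.update_self, Function.update_of_ne hj.1.ne,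
      Function.update_of_ne hj.2.ne', ← Finset.smul_sum, hscore, smul_zero,
      Finset.sum_const_zero]
  obtain ⟨C, hC⟩ := exists_sum_segLik_smul E T hpmf θ k
  have h := sum_segLik_succ_children_smul hC ha hG
  rw [hsum, smul_zero] at h
  rw [← h]
  refine Finset.sum_congr rfl fun τ _ => ?_
  simp only [G]
  rw [← smul_gradient_log (hdiff _ _ _ θ) (hpos _ _ _ _).ne', smul_smul, smul_smul, segLik]
  congr 1
  ring

lemma sum_trajProb_smul_gradient_log_eq_zero (hpos : ∀ θ s g m, 0 < π θ s g m)
    (hpmf : ∀ θ s g, ∑ m, π θ s g m = 1)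
    (hdiff : ∀ s g m, Differentiable ℝ fun θ => π θ s g m) (ρ₀ : S → S → ℝ) (θ : E)
    {D k i : ℕ} (hk : k < D) (hi : i < 2 ^ (D - (k + 1))) {F : (ℕ → S) → ℝ}
    (hF : DependsOn F (Set.Ioo (i * 2 ^ (k + 1)) ((i + 1) * 2 ^ (k + 1)))ᶜ) :
    ∑ τ : Fin (2 ^ D + 1) → S, (trajProb ρ₀ π D θ τ * F (liftT τ)) •
      gradient (fun θ' => Real.log (π θ' (liftT τ (i * 2 ^ (k + 1)))
        (liftT τ ((i + 1) * 2 ^ (k + 1))) (liftT τ ((2 * i + 1) * 2 ^ k)))) θ = 0 := by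
  obtain ⟨e, rfl⟩ : ∃ e, D = k + 1 + e := Nat.exists_eq_add_of_le hk
  rw [Nat.add_sub_cancel_left] at hi
  obtain ⟨R, hR, hfac⟩ := exists_segLik_eq_mul π θ (k + 1) e 0 i hi
  have hend : (i + 1) * 2 ^ (k + 1) = i * 2 ^ (k + 1) + 2 ^ (k + 1) := by ring
  have hmid : (2 * i + 1) * 2 ^ k = i * 2 ^ (k + 1) + 2 ^ k := by ring
  have hle : i * 2 ^ (k + 1) + 2 ^ (k + 1) ≤ 2 ^ (k + 1 + e) := by
    rw [pow_add _ (k + 1), mul_comm (2 ^ (k + 1)) (2 ^ e), ← Nat.succ_mul]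
    exact Nat.mul_le_mul_right _ hi
  rw [zero_add] at hR hfac
  rw [hend] at hF ⊢
  rw [hmid]
  have hdep : DependsOn (fun x : ℕ → S => ρ₀ (x 0) (x (2 ^ (k + 1 + e))) * R x * F x)
      (Set.Ioo (i * 2 ^ (k + 1)) (i * 2 ^ (k + 1) + 2 ^ (k + 1)))ᶜ := by
    intro x y h
    simp only
    rw [hR h, hF h, h 0 fun ht => by have := ht.1; omega,
      h (2 ^ (k + 1 + e)) fun ht => by have := ht.2; omega]
  rw [← sum_segLik_smul_gradient_log_eq_zero hpos hpmf hdiff θ hle hdep]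
  refine Finset.sum_congr rfl fun τ _ => ?_
  rw [trajProb, hfac]
  congr 1
  ring

end Score

/-- **Sub-goal tree policy gradient theorem.** With
`J(θ) = Σ_τ c_τ · Pr_θ[τ]`, `J` is differentiable and
`∇_θ J(θ) = Σ_τ Pr_θ[τ] · c_τ · ∇_θ log Pr_θ[τ]
          = Σ_τ Pr_θ[τ] · Σ_{d,i} C_τ^{i,d} · ∇_θ log π_θ(s_m^{i,d} | s^{i,d}, g^{i,d})`,
and for any baseline `b : S × S → ℝ` the same holds with `C_τ^{i,d} − b(s^{i,d}, g^{i,d})`. -/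
theorem sgt_policy_gradient_theorem
    {S : Type*} [Fintype S] [Nonempty S] [DecidableEq S] {n D : ℕ}
    (hn : 1 ≤ n) (hD : 1 ≤ D)
    (c : S → S → ℝ)
    (π : EuclideanSpace ℝ (Fin n) → S → S → S → ℝ)
    (hpos : ∀ (θ : EuclideanSpace ℝ (Fin n)) (s g m : S), 0 < π θ s g m)
    (hpmf : ∀ (θ : EuclideanSpace ℝ (Fin n)) (s g : S), ∑ m : S, π θ s g m = 1)
    (hdiff : ∀ s g m : S, Differentiable ℝ fun θ : EuclideanSpace ℝ (Fin n) => π θ s g m)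
    (ρ₀ : S → S → ℝ) (hρpos : ∀ s g : S, 0 < ρ₀ s g)
    (hρpmf : ∑ s : S, ∑ g : S, ρ₀ s g = 1)
    (J : EuclideanSpace ℝ (Fin n) → ℝ)
    (hJ : ∀ θ : EuclideanSpace ℝ (Fin n),
      J θ = ∑ τ : Fin (2 ^ D + 1) → S, segCost c τ 0 (2 ^ D) * trajProb ρ₀ π D θ τ) :
    Differentiable ℝ J ∧
    ∀ θ : EuclideanSpace ℝ (Fin n),
      (gradient J θ =
        ∑ τ : Fin (2 ^ D + 1) → S,
          (trajProb ρ₀ π D θ τ * segCost c τ 0 (2 ^ D)) •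
            gradient (fun θ' : EuclideanSpace ℝ (Fin n) =>
              Real.log (trajProb ρ₀ π D θ' τ)) θ) ∧
      (gradient J θ =
        ∑ τ : Fin (2 ^ D + 1) → S,
          trajProb ρ₀ π D θ τ •
            ∑ d ∈ Finset.Icc 1 D, ∑ i ∈ Finset.Icc 1 (2 ^ (D - d)),
              segCost c τ ((i - 1) * 2 ^ d) (i * 2 ^ d) •
                gradient (fun θ' : EuclideanSpace ℝ (Fin n) =>
                  Real.log (π θ' (liftT τ ((i - 1) * 2 ^ d)) (liftT τ (i * 2 ^ d))
                    (liftT τ ((2 * i - 1) * 2 ^ (d - 1))))) θ) ∧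
      (∀ b : S → S → ℝ,
        gradient J θ =
          ∑ τ : Fin (2 ^ D + 1) → S,
            trajProb ρ₀ π D θ τ •
              ∑ d ∈ Finset.Icc 1 D, ∑ i ∈ Finset.Icc 1 (2 ^ (D - d)),
                (segCost c τ ((i - 1) * 2 ^ d) (i * 2 ^ d) -
                    b (liftT τ ((i - 1) * 2 ^ d)) (liftT τ (i * 2 ^ d))) •
                  gradient (fun θ' : EuclideanSpace ℝ (Fin n) =>
                    Real.log (π θ' (liftT τ ((i - 1) * 2 ^ d)) (liftT τ (i * 2 ^ d))
                      (liftT τ ((2 * i - 1) * 2 ^ (d - 1))))) θ) := by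
  have hPpos : ∀ θ τ, trajProb ρ₀ π D θ τ ≠ 0 := fun θ τ =>
    (mul_pos (hρpos _ _) (segLik_pos hpos _ _ _ _)).ne'
  have hPdiff : ∀ τ, Differentiable ℝ fun θ => trajProb ρ₀ π D θ τ := fun τ =>
    (differentiable_segLik hdiff _ _ _).const_mul _
  obtain rfl : J = fun θ => ∑ τ : Fin (2 ^ D + 1) → S,
    segCost c τ 0 (2 ^ D) * trajProb ρ₀ π D θ τ := funext hJ
  refine ⟨Differentiable.fun_sum fun τ _ => (hPdiff τ).const_mul _, fun θ => ?_⟩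
  have hgrad : gradient (fun θ => ∑ τ : Fin (2 ^ D + 1) → S,
      segCost c τ 0 (2 ^ D) * trajProb ρ₀ π D θ τ) θ =
      ∑ τ : Fin (2 ^ D + 1) → S, (trajProb ρ₀ π D θ τ * segCost c τ 0 (2 ^ D)) •
        gradient (fun θ' => Real.log (trajProb ρ₀ π D θ' τ)) θ := by
    rw [gradient_fun_sum _ fun τ _ => ((hPdiff τ).const_mul _) θ]
    refine Finset.sum_congr rfl fun τ _ => ?_
    rw [gradient_fun_const_mul (hPdiff τ θ), mul_comm, mul_smul,
      smul_gradient_log (hPdiff τ θ) (hPpos θ τ)]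
  have hbase : ∀ b : S → S → ℝ, gradient (fun θ => ∑ τ : Fin (2 ^ D + 1) → S,
      segCost c τ 0 (2 ^ D) * trajProb ρ₀ π D θ τ) θ =
      ∑ τ : Fin (2 ^ D + 1) → S, trajProb ρ₀ π D θ τ •
        ∑ d ∈ Finset.Icc 1 D, ∑ i ∈ Finset.Icc 1 (2 ^ (D - d)),
          (segCost c τ ((i - 1) * 2 ^ d) (i * 2 ^ d) -
              b (liftT τ ((i - 1) * 2 ^ d)) (liftT τ (i * 2 ^ d))) •
            gradient (fun θ' : EuclideanSpace ℝ (Fin n) =>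
              Real.log (π θ' (liftT τ ((i - 1) * 2 ^ d)) (liftT τ (i * 2 ^ d))
                (liftT τ ((2 * i - 1) * 2 ^ (d - 1))))) θ := by
    intro b
    have hodd : ∀ j : ℕ, 2 * (j + 1) - 1 = 2 * j + 1 := fun j => by omega
    rw [hgrad, ← sub_eq_zero, ← Finset.sum_sub_distrib]
    simp only [gradient_log_trajProb hpos hdiff hρpos, sum_Icc_one_eq_sum_range,
      Nat.add_sub_cancel, hodd, mul_smul, ← smul_sub, Finset.smul_sum,
      ← Finset.sum_sub_distrib, ← sub_smul]
    rw [Finset.sum_comm]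
    refine Finset.sum_eq_zero fun k hk => ?_
    rw [Finset.sum_comm]
    refine Finset.sum_eq_zero fun j hj => ?_
    rw [Finset.mem_range] at hk hj
    have hend : j * 2 ^ (k + 1) ≤ (j + 1) * 2 ^ (k + 1) :=
      Nat.mul_le_mul_right _ (Nat.le_succ j)
    have hle : (j + 1) * 2 ^ (k + 1) ≤ 2 ^ D :=
      calc (j + 1) * 2 ^ (k + 1) ≤ 2 ^ (D - (k + 1)) * 2 ^ (k + 1) := Nat.mul_le_mul_right _ hj
        _ = 2 ^ D := by rw [← pow_add, Nat.sub_add_cancel hk]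
    have hF : DependsOn (fun x : ℕ → S =>
        ∑ t ∈ Finset.Ico 0 (j * 2 ^ (k + 1)), c (x t) (x (t + 1)) +
        ∑ t ∈ Finset.Ico ((j + 1) * 2 ^ (k + 1)) (2 ^ D), c (x t) (x (t + 1)) +
        b (x (j * 2 ^ (k + 1))) (x ((j + 1) * 2 ^ (k + 1))))
        (Set.Ioo (j * 2 ^ (k + 1)) ((j + 1) * 2 ^ (k + 1)))ᶜ := by
      intro x y h
      have hlo : ∀ t, t ≤ j * 2 ^ (k + 1) → x t = y t :=
        fun t ht => h t fun ht' => ht.not_gt ht'.1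
      have hhi : ∀ t, (j + 1) * 2 ^ (k + 1) ≤ t → x t = y t :=
        fun t ht => h t fun ht' => ht.not_gt ht'.2
      simp only
      rw [hlo _ le_rfl, hhi _ le_rfl]
      congr 2
      · refine Finset.sum_congr rfl fun t ht => ?_
        have := (Finset.mem_Ico.mp ht).2
        rw [hlo t this.le, hlo (t + 1) this]
      · refine Finset.sum_congr rfl fun t ht => ?_
        have := (Finset.mem_Ico.mp ht).1
        rw [hhi t this, hhi (t + 1) (this.trans (Nat.le_succ t))]
    rw [← sum_trajProb_smul_gradient_log_eq_zero hpos hpmf hdiff ρ₀ θ hk hj hF]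
    refine Finset.sum_congr rfl fun τ _ => ?_
    rw [← mul_smul]
    congr 2
    simp only [segCost]
    rw [← Finset.sum_Ico_consecutive _ (Nat.zero_le _) (hend.trans hle),
      ← Finset.sum_Ico_consecutive _ hend hle]
    ring
  exact ⟨hgrad, by simpa only [sub_zero] using hbase fun _ _ => 0, hbase⟩
end
end
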